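/- arXiv:1306.3142 — 2 statements merged into one kernel-verified Lean document; each statement's English description precedes it below -/
import Mathlib

section
/- Let α ∈ (0, 1) ∪ (1, ∞), let ρ, σ be positive semidefinite complex n×n matrices with ρ ≠ 0, and let τ, ω be positive semidefinite complex m×m matrices with τ ≠ 0. Then D̃_α(ρ ⊗ τ ‖ σ ⊗ ω) = D̃_α(ρ‖σ) + D̃_α(τ‖ω), as an identity in ℝ ∪ {+∞}, where ⊗ denotes the Kronecker product. -/
open Matrix
open scoped Kronecker Classical ComplexOrder

/-- Real power of a matrix via functional calculus on the eigenvalues of a Hermitian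
matrix, with the convention that eigenvalue `0` is mapped to `0` (powers are taken on
the support). Non-Hermitian matrices are mapped to `0`. -/
noncomputable def matPow {n : Type*} [Fintype n] [DecidableEq n]
    (A : Matrix n n ℂ) (t : ℝ) : Matrix n n ℂ :=
  if hA : A.IsHermitian then
    (hA.eigenvectorUnitary : Matrix n n ℂ) *
      Matrix.diagonal (fun i =>
        ((if hA.eigenvalues i = 0 then (0 : ℝ) else hA.eigenvalues i ^ t : ℝ) : ℂ)) *
      (star (hA.eigenvectorUnitary : Matrix n n ℂ))
  else 0

/-- `dominates σ ρ` (written `σ ≫ ρ` in the paper): the kernel of `σ` is contained in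
the kernel of `ρ`. -/
def dominates {n : Type*} [Fintype n] (σ ρ : Matrix n n ℂ) : Prop :=
  ∀ v : n → ℂ, σ.mulVec v = 0 → ρ.mulVec v = 0

/-- The sandwiched Rényi divergence of order `α`, with values in `ℝ ∪ {+∞}` (as a
subset of `EReal`), logarithms base 2. It is `+∞` unless `ρ` is not orthogonal to `σ`
(i.e. `Tr[ρσ] ≠ 0`) and (`σ ≫ ρ` or `α < 1`). -/
noncomputable def Dtilde {n : Type*} [Fintype n] [DecidableEq n]
    (α : ℝ) (ρ σ : Matrix n n ℂ) : EReal :=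
  if (ρ * σ).trace ≠ 0 ∧ (dominates σ ρ ∨ α < 1) then
    (((α - 1)⁻¹ * Real.logb 2
        ((matPow (matPow σ ((1 - α) / (2 * α)) * ρ * matPow σ ((1 - α) / (2 * α))) α).trace.re
          / ρ.trace.re) : ℝ) : EReal)
  else ⊤

section PosSemidef

variable {n m : Type*} [Fintype n] [Fintype m]

lemma kronecker_eq_zero {A : Matrix n n ℂ} {B : Matrix m m ℂ} (h : A ⊗ₖ B = 0) :
    A = 0 ∨ B = 0 := by
  by_contra! hAB
  obtain ⟨hA, hB⟩ := hAB
  apply hA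
  ext i j
  by_contra hij
  apply hB
  ext k l
  have : A i j * B k l = 0 := congrFun (congrFun h (i, k)) (j, l)
  exact (mul_eq_zero.mp this).resolve_left hij

lemma Matrix.PosSemidef.sandwich {ρ S : Matrix n n ℂ} (hρ : ρ.PosSemidef) (hS : S.IsHermitian) :
    (S * ρ * S).PosSemidef := by
  simpa only [hS.eq] using hρ.mul_mul_conjTranspose_same S

lemma Matrix.PosSemidef.trace_im {A : Matrix n n ℂ} (hA : A.PosSemidef) : A.trace.im = 0 :=
  (Complex.le_def.mp hA.trace_nonneg).2.symm

lemma Matrix.PosSemidef.trace_re_ne_zero {A : Matrix n n ℂ} (hA : A.PosSemidef) (hA0 : A ≠ 0) :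
    A.trace.re ≠ 0 := fun h =>
  hA0 (hA.trace_eq_zero_iff.mp (Complex.ext h hA.trace_im))

lemma trace_re_kronecker {A : Matrix n n ℂ} (hA : A.PosSemidef) (B : Matrix m m ℂ) :
    (A ⊗ₖ B).trace.re = A.trace.re * B.trace.re := by
  rw [trace_kronecker, Complex.mul_re, hA.trace_im, zero_mul, sub_zero]

end PosSemidef

section MatPow

variable {n m : Type*} [Fintype n] [DecidableEq n] [Fintype m] [DecidableEq m]

/-- The scalar function underlying `matPow`. -/
noncomputable def supportRpow (t x : ℝ) : ℝ := if x = 0 then 0 else x ^ t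

lemma supportRpow_one (x : ℝ) : supportRpow 1 x = x := by
  unfold supportRpow; split_ifs with h <;> simp [h]

lemma supportRpow_nonneg (t : ℝ) {x : ℝ} (hx : 0 ≤ x) : 0 ≤ supportRpow t x := by
  unfold supportRpow; split_ifs
  · exact le_rfl
  · positivity

lemma supportRpow_mul (t : ℝ) {x y : ℝ} (hx : 0 ≤ x) (hy : 0 ≤ y) :
    supportRpow t (x * y) = supportRpow t x * supportRpow t y := by
  unfold supportRpow
  by_cases h : x = 0
  · simp [h]
  by_cases h' : y = 0
  · simp [h']
  simp [h, h', Real.mul_rpow hx hy]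

lemma supportRpow_add (s t : ℝ) {x : ℝ} (hx : 0 ≤ x) :
    supportRpow (s + t) x = supportRpow s x * supportRpow t x := by
  unfold supportRpow
  by_cases h : x = 0
  · simp [h]
  simp [h, Real.rpow_add (lt_of_le_of_ne hx (Ne.symm h))]

/-- The matrix with eigenvalues `d` in the basis given by the columns of `U`. -/
noncomputable def unitaryDiag (U : Matrix n n ℂ) (d : n → ℝ) : Matrix n n ℂ :=
  U * diagonal (fun i => (d i : ℂ)) * star U

lemma unitaryDiag_congr_fun {U V : Matrix n n ℂ} (hU : U ∈ unitaryGroup n ℂ)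
    (hV : V ∈ unitaryGroup n ℂ) {d e : n → ℝ} (h : unitaryDiag U d = unitaryDiag V e)
    (f : ℝ → ℝ) : unitaryDiag U (f ∘ d) = unitaryDiag V (f ∘ e) := by
  have hU1 := mem_unitaryGroup_iff.mp hU
  have hU2 := mem_unitaryGroup_iff'.mp hU
  have hV1 := mem_unitaryGroup_iff.mp hV
  have hV2 := mem_unitaryGroup_iff'.mp hV
  have intertwine : ∀ a b : n → ℝ, unitaryDiag U a = unitaryDiag V b ↔
      (star V * U) * diagonal (fun i => (a i : ℂ)) =
        diagonal (fun i => (b i : ℂ)) * (star V * U) := by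
    intro a b
    unfold unitaryDiag
    constructor
    · intro h
      calc (star V * U) * diagonal (fun i => (a i : ℂ))
          = star V * (U * diagonal (fun i => (a i : ℂ)) * star U) * U := by
            simp only [Matrix.mul_assoc, hU2, Matrix.mul_one]
        _ = (star V * V) * diagonal (fun i => (b i : ℂ)) * (star V * U) := by
            rw [h]; simp only [Matrix.mul_assoc]
        _ = _ := by rw [hV2, Matrix.one_mul]
    · intro h
      calc U * diagonal (fun i => (a i : ℂ)) * star U
          = (V * star V) * U * diagonal (fun i => (a i : ℂ)) * star U := by
            rw [hV1, Matrix.one_mul]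
        _ = V * ((star V * U) * diagonal (fun i => (a i : ℂ))) * star U := by
            simp only [Matrix.mul_assoc]
        _ = V * diagonal (fun i => (b i : ℂ)) * star V * (U * star U) := by
            rw [h]; simp only [Matrix.mul_assoc]
        _ = _ := by rw [hU1, Matrix.mul_one]
  rw [intertwine] at h ⊢
  ext i j
  have hij := congrFun (congrFun h i) j
  simp only [mul_diagonal, diagonal_mul, Function.comp] at hij ⊢
  by_cases hw : (star V * U) i j = 0
  · simp [hw]
  · have : (d j : ℂ) = e i := by
      rw [mul_comm] at hij
      exact mul_right_cancel₀ hw hij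
    rw [Complex.ofReal_inj.mp this, mul_comm]

lemma isHermitian_unitaryDiag (U : Matrix n n ℂ) (d : n → ℝ) :
    (unitaryDiag U d).IsHermitian := by
  have : star (fun i => (d i : ℂ)) = fun i => (d i : ℂ) := by
    ext i; simp
  unfold unitaryDiag
  simp only [IsHermitian, star_eq_conjTranspose, conjTranspose_mul, conjTranspose_conjTranspose,
    diagonal_conjTranspose, this, Matrix.mul_assoc]

lemma eq_unitaryDiag {A : Matrix n n ℂ} (hA : A.IsHermitian) :
    A = unitaryDiag (hA.eigenvectorUnitary : Matrix n n ℂ) hA.eigenvalues := by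
  conv_lhs => rw [hA.spectral_theorem]
  rfl

lemma matPow_of_isHermitian {A : Matrix n n ℂ} (hA : A.IsHermitian) (t : ℝ) :
    matPow A t =
      unitaryDiag (hA.eigenvectorUnitary : Matrix n n ℂ) (supportRpow t ∘ hA.eigenvalues) := by
  rw [matPow, dif_pos hA]
  simp only [unitaryDiag, supportRpow, Function.comp_apply]

lemma matPow_unitaryDiag {U : Matrix n n ℂ} (hU : U ∈ unitaryGroup n ℂ) (d : n → ℝ) (t : ℝ) :
    matPow (unitaryDiag U d) t = unitaryDiag U (supportRpow t ∘ d) := by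
  have hA := isHermitian_unitaryDiag U d
  rw [matPow_of_isHermitian hA]
  exact unitaryDiag_congr_fun hA.eigenvectorUnitary.2 hU (eq_unitaryDiag hA).symm (supportRpow t)

lemma unitaryDiag_mul {U : Matrix n n ℂ} (hU : U ∈ unitaryGroup n ℂ) (d e : n → ℝ) :
    unitaryDiag U d * unitaryDiag U e = unitaryDiag U (d * e) := by
  have hU2 := mem_unitaryGroup_iff'.mp hU
  unfold unitaryDiag
  calc _ = U * diagonal (fun i => (d i : ℂ)) * (star U * U) * diagonal (fun i => (e i : ℂ))
        * star U := by simp only [Matrix.mul_assoc]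
    _ = _ := by
      rw [hU2, Matrix.mul_one, Matrix.mul_assoc U, diagonal_mul_diagonal]
      simp

lemma unitaryDiag_kronecker (U : Matrix n n ℂ) (V : Matrix m m ℂ) (d : n → ℝ) (e : m → ℝ) :
    unitaryDiag U d ⊗ₖ unitaryDiag V e = unitaryDiag (U ⊗ₖ V) (fun p => d p.1 * e p.2) := by
  simp only [unitaryDiag, mul_kronecker_mul, diagonal_kronecker_diagonal, star_eq_conjTranspose,
    conjTranspose_kronecker, Complex.ofReal_mul]

lemma exists_unitaryDiag {A : Matrix n n ℂ} (hA : A.PosSemidef) :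
    ∃ U ∈ unitaryGroup n ℂ, ∃ d : n → ℝ, (∀ i, 0 ≤ d i) ∧ A = unitaryDiag U d :=
  ⟨_, hA.1.eigenvectorUnitary.2, _, hA.eigenvalues_nonneg, eq_unitaryDiag hA.1⟩

lemma posSemidef_unitaryDiag (U : Matrix n n ℂ) {d : n → ℝ} (hd : ∀ i, 0 ≤ d i) :
    (unitaryDiag U d).PosSemidef := by
  have : (diagonal (fun i => (d i : ℂ))).PosSemidef :=
    PosSemidef.diagonal fun i => Complex.zero_le_real.mpr (hd i)
  exact this.mul_mul_conjTranspose_same U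

lemma posSemidef_matPow {A : Matrix n n ℂ} (hA : A.PosSemidef) (t : ℝ) :
    (matPow A t).PosSemidef := by
  obtain ⟨U, hU, d, hd, rfl⟩ := exists_unitaryDiag hA
  rw [matPow_unitaryDiag hU]
  exact posSemidef_unitaryDiag U fun i => supportRpow_nonneg t (hd i)

lemma matPow_one {A : Matrix n n ℂ} (hA : A.PosSemidef) : matPow A 1 = A := by
  obtain ⟨U, hU, d, -, rfl⟩ := exists_unitaryDiag hA
  rw [matPow_unitaryDiag hU]
  congr 1
  ext i
  exact supportRpow_one _

lemma matPow_add {A : Matrix n n ℂ} (hA : A.PosSemidef) (s t : ℝ) :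
    matPow A (s + t) = matPow A s * matPow A t := by
  obtain ⟨U, hU, d, hd, rfl⟩ := exists_unitaryDiag hA
  simp only [matPow_unitaryDiag hU, unitaryDiag_mul hU]
  congr 1
  ext i
  exact supportRpow_add s t (hd i)

lemma matPow_kronecker {A : Matrix n n ℂ} {B : Matrix m m ℂ} (hA : A.PosSemidef)
    (hB : B.PosSemidef) (t : ℝ) : matPow (A ⊗ₖ B) t = matPow A t ⊗ₖ matPow B t := by
  obtain ⟨U, hU, d, hd, rfl⟩ := exists_unitaryDiag hA
  obtain ⟨V, hV, e, he, rfl⟩ := exists_unitaryDiag hB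
  rw [unitaryDiag_kronecker, matPow_unitaryDiag (kronecker_mem_unitary hU hV),
    matPow_unitaryDiag hU, matPow_unitaryDiag hV, unitaryDiag_kronecker]
  congr 1
  ext p
  exact supportRpow_mul t (hd p.1) (he p.2)

lemma matPow_ne_zero {A : Matrix n n ℂ} (hA : A.PosSemidef) (hA0 : A ≠ 0) (t : ℝ) :
    matPow A t ≠ 0 := by
  intro h
  apply hA0
  rw [← matPow_one hA, ← add_sub_cancel t 1, matPow_add hA, h, Matrix.zero_mul]

lemma dominates_iff {σ : Matrix n n ℂ} (hσ : σ.PosSemidef) (ρ : Matrix n n ℂ) :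
    dominates σ ρ ↔ ρ * matPow σ 0 = ρ := by
  constructor
  · intro h
    have hσP : σ * (1 - matPow σ 0) = 0 := by
      have := matPow_add hσ 1 0
      rw [add_zero, matPow_one hσ] at this
      rw [Matrix.mul_sub, ← this, Matrix.mul_one, sub_self]
    have hρP : ρ * (1 - matPow σ 0) = 0 := by
      ext i j
      have := h (fun k => (1 - matPow σ 0) k j)
        (funext fun k => congrFun (congrFun hσP k) j)
      exact congrFun this i
    rw [Matrix.mul_sub, Matrix.mul_one, sub_eq_zero] at hρP
    exact hρP.symm
  · intro h v hv
    have hP : matPow σ 0 = matPow σ (-1) * σ := by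
      rw [← neg_add_cancel (1 : ℝ), matPow_add hσ, matPow_one hσ]
    rw [← h, hP, ← mulVec_mulVec, ← mulVec_mulVec, hv, mulVec_zero, mulVec_zero]

lemma dominates_kronecker_iff {ρ σ : Matrix n n ℂ} {τ ω : Matrix m m ℂ} (hσ : σ.PosSemidef)
    (hω : ω.PosSemidef) (hρ0 : ρ ≠ 0) (hτ0 : τ ≠ 0) :
    dominates (σ ⊗ₖ ω) (ρ ⊗ₖ τ) ↔ dominates σ ρ ∧ dominates ω τ := by
  rw [dominates_iff (hσ.kronecker hω), dominates_iff hσ, dominates_iff hω,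
    matPow_kronecker hσ hω, ← mul_kronecker_mul]
  refine ⟨fun h => ?_, fun ⟨h₁, h₂⟩ => by rw [h₁, h₂]⟩
  have hP : matPow σ 0 * matPow σ 0 = matPow σ 0 := by rw [← matPow_add hσ, add_zero]
  have hQ : matPow ω 0 * matPow ω 0 = matPow ω 0 := by rw [← matPow_add hω, add_zero]
  have hne : ρ ⊗ₖ τ ≠ 0 := fun h0 => (kronecker_eq_zero h0).elim hρ0 hτ0
  constructor
  · have h1 : (ρ * matPow σ 0 - ρ) ⊗ₖ (τ * matPow ω 0) = 0 := by
      have := congrArg (· * ((1 : Matrix n n ℂ) ⊗ₖ matPow ω 0)) h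
      simp only [← mul_kronecker_mul, Matrix.mul_one, Matrix.mul_assoc, hQ] at this
      rw [sub_eq_add_neg, add_kronecker, this, ← add_kronecker, add_neg_cancel, zero_kronecker]
    rcases kronecker_eq_zero h1 with h2 | h2
    · exact sub_eq_zero.mp h2
    · rw [h2, kronecker_zero] at h
      exact absurd h.symm hne
  · have h1 : (ρ * matPow σ 0) ⊗ₖ (τ * matPow ω 0 - τ) = 0 := by
      have := congrArg (· * (matPow σ 0 ⊗ₖ (1 : Matrix m m ℂ))) h
      simp only [← mul_kronecker_mul, Matrix.mul_one, Matrix.mul_assoc, hP] at this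
      rw [sub_eq_add_neg, kronecker_add, this, ← kronecker_add, add_neg_cancel, kronecker_zero]
    rcases kronecker_eq_zero h1 with h2 | h2
    · rw [h2, zero_kronecker] at h
      exact absurd h.symm hne
    · exact sub_eq_zero.mp h2

lemma sandwich_matPow_ne_zero {ρ σ : Matrix n n ℂ} (hρ : ρ.PosSemidef) (hσ : σ.PosSemidef)
    (h : (ρ * σ).trace ≠ 0) (s : ℝ) : matPow σ s * ρ * matPow σ s ≠ 0 := by
  intro h0
  apply h
  have hS := (posSemidef_matPow hσ s).1
  have hσ' : σ = matPow σ s * matPow σ (1 - s) := by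
    rw [← matPow_add hσ, add_sub_cancel, matPow_one hσ]
  have hρS : ρ * matPow σ s = 0 := by
    have hR : matPow ρ (1 / 2) * matPow ρ (1 / 2) = ρ := by
      rw [← matPow_add hρ, add_halves, matPow_one hρ]
    have hRS : matPow ρ (1 / 2) * matPow σ s = 0 := by
      rw [← conjTranspose_mul_self_eq_zero, conjTranspose_mul, hS.eq,
        (posSemidef_matPow hρ (1 / 2)).1.eq, Matrix.mul_assoc, ← Matrix.mul_assoc (matPow ρ _), hR,
        ← Matrix.mul_assoc, h0]
    rw [← hR, Matrix.mul_assoc, hRS, Matrix.mul_zero]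
  rw [hσ', ← Matrix.mul_assoc, hρS, Matrix.zero_mul, trace_zero]

end MatPow

/-- additivity of the sandwiched Rényi divergence under tensor
(Kronecker) products. -/
theorem stmt1 {n m : ℕ} {α : ℝ} (hα : α ∈ Set.Ioo (0 : ℝ) 1 ∪ Set.Ioi 1)
    {ρ σ : Matrix (Fin n) (Fin n) ℂ} {τ ω : Matrix (Fin m) (Fin m) ℂ}
    (hρ : ρ.PosSemidef) (hσ : σ.PosSemidef) (hτ : τ.PosSemidef) (hω : ω.PosSemidef)
    (hρ0 : ρ ≠ 0) (hτ0 : τ ≠ 0) :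
    Dtilde α (ρ ⊗ₖ τ) (σ ⊗ₖ ω) = Dtilde α ρ σ + Dtilde α τ ω := by
  have hcond : ((ρ ⊗ₖ τ * σ ⊗ₖ ω).trace ≠ 0 ∧ (dominates (σ ⊗ₖ ω) (ρ ⊗ₖ τ) ∨ α < 1)) ↔
      ((ρ * σ).trace ≠ 0 ∧ (dominates σ ρ ∨ α < 1)) ∧
        ((τ * ω).trace ≠ 0 ∧ (dominates ω τ ∨ α < 1)) := by
    rw [dominates_kronecker_iff hσ hω hρ0 hτ0, ← mul_kronecker_mul, trace_kronecker,
      mul_ne_zero_iff]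
    tauto
  by_cases h₁ : (ρ * σ).trace ≠ 0 ∧ (dominates σ ρ ∨ α < 1)
  swap
  · rw [Dtilde, Dtilde, if_neg (fun h => h₁ (hcond.mp h).1), if_neg h₁, Dtilde]
    split_ifs
    · exact (EReal.top_add_coe _).symm
    · exact EReal.top_add_top.symm
  by_cases h₂ : (τ * ω).trace ≠ 0 ∧ (dominates ω τ ∨ α < 1)
  swap
  · rw [Dtilde, Dtilde, if_neg (fun h => h₂ (hcond.mp h).2), if_pos h₁, Dtilde, if_neg h₂]
    exact (EReal.coe_add_top _).symm
  rw [Dtilde, Dtilde, Dtilde, if_pos (hcond.mpr ⟨h₁, h₂⟩), if_pos h₁, if_pos h₂, ← EReal.coe_add]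
  congr 1
  set s := (1 - α) / (2 * α)
  have hX := hρ.sandwich (posSemidef_matPow hσ s).1
  have hY := hτ.sandwich (posSemidef_matPow hω s).1
  have hX0 := sandwich_matPow_ne_zero hρ hσ h₁.1 s
  have hY0 := sandwich_matPow_ne_zero hτ hω h₂.1 s
  have hXt := (posSemidef_matPow hX α).trace_re_ne_zero (matPow_ne_zero hX hX0 α)
  have hYt := (posSemidef_matPow hY α).trace_re_ne_zero (matPow_ne_zero hY hY0 α)
  rw [matPow_kronecker hσ hω, ← mul_kronecker_mul, ← mul_kronecker_mul, matPow_kronecker hX hY,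
    trace_re_kronecker (posSemidef_matPow hX α), trace_re_kronecker hρ, mul_div_mul_comm,
    Real.logb_mul (div_ne_zero hXt (hρ.trace_re_ne_zero hρ0))
      (div_ne_zero hYt (hτ.trace_re_ne_zero hτ0)), mul_add]
end

section
/- Let ρ, σ be positive semidefinite complex n×n matrices with ρ ≠ 0 and σ ≫ ρ. Then D̃_α(ρ‖σ) converges to the quantum relative entropy D(ρ‖σ) = Tr[ρ (log ρ − log σ)] / Tr[ρ] both as α → 1 from below and as α → 1 from above. Here log ρ and log σ are the base-2 matrix logarithms taken on the respective supports (eigenvalue 0 is mapped to 0). -/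
open Matrix
open scoped Kronecker Classical ComplexOrder

/-- Base-2 matrix logarithm of a Hermitian matrix, by functional calculus, with the
eigenvalue `0` mapped to `0` (the logarithm is taken on the support). -/
noncomputable def matLog2 {n : Type*} [Fintype n] [DecidableEq n]
    (A : Matrix n n ℂ) : Matrix n n ℂ :=
  if hA : A.IsHermitian then
    (hA.eigenvectorUnitary : Matrix n n ℂ) *
      Matrix.diagonal (fun i =>
        ((if hA.eigenvalues i = 0 then (0 : ℝ) else Real.logb 2 (hA.eigenvalues i) : ℝ) : ℂ)) *
      (star (hA.eigenvectorUnitary : Matrix n n ℂ))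
  else 0

open Filter Topology

section PowerFunction

lemma continuousOn_rpow_mul_log :
    ContinuousOn (Function.uncurry fun c x : ℝ => x ^ c * Real.log x)
      (Set.Ioi (1 / 2) ×ˢ Set.Ici 0) := by
  have hG : ContinuousOn
      (fun p : ℝ × ℝ => p.2 ^ (p.1 - 1 / 2) * (2 * (√p.2 * Real.log √p.2)))
      (Set.Ioi (1 / 2) ×ˢ Set.Ici 0) := by
    intro p hp
    have hp1 : (1 / 2 : ℝ) < p.1 := hp.1
    have h1 : ContinuousAt (fun p : ℝ × ℝ => p.2 ^ (p.1 - 1 / 2)) p :=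
      ContinuousAt.rpow (by fun_prop) (by fun_prop) (Or.inr (by linarith))
    have h2 : Continuous fun p : ℝ × ℝ => 2 * (√p.2 * Real.log √p.2) :=
      continuous_const.mul (Real.continuous_mul_log.comp (by fun_prop))
    exact (h1.mul h2.continuousAt).continuousWithinAt
  refine hG.congr fun p hp => ?_
  have hp1 : (1 / 2 : ℝ) < p.1 := hp.1
  have hp2 : (0 : ℝ) ≤ p.2 := hp.2
  have h : p.2 ^ p.1 = p.2 ^ (p.1 - 1 / 2) * √p.2 := by
    rw [Real.sqrt_eq_rpow, ← Real.rpow_add_of_nonneg hp2 (by linarith) (by norm_num)]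
    congr 1; ring
  simp only [Function.uncurry_def]
  rw [h, Real.log_sqrt hp2]
  ring

/-- The difference quotients of `α ↦ x ^ α` at `1` converge to `x * log x` uniformly for `x` in a
bounded interval. -/
lemma eventually_forall_abs_rpow_sub_le (R : ℝ) {ε : ℝ} (hε : 0 < ε) :
    ∀ᶠ α in 𝓝[≠] (1 : ℝ), ∀ x ∈ Set.Icc 0 R,
      |(x ^ α - x) / (α - 1) - x * Real.log x| ≤ ε := by
  obtain ⟨v, hv, hvε⟩ := (isCompact_Icc (a := (0 : ℝ)) (b := R)).mem_uniformity_of_prod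
    (f := fun c x : ℝ => x ^ c * Real.log x) (s := Set.Ioi (1 / 2)) (q := 1)
    (continuousOn_rpow_mul_log.mono (Set.prod_mono_right Set.Icc_subset_Ici_self))
    (by norm_num) (Metric.dist_mem_uniformity hε)
  rw [IsOpen.nhdsWithin_eq isOpen_Ioi (by norm_num), Metric.mem_nhds_iff] at hv
  obtain ⟨δ, hδ, hball⟩ := hv
  filter_upwards [nhdsWithin_le_nhds (Metric.ball_mem_nhds (1 : ℝ) hδ), self_mem_nhdsWithin,
    nhdsWithin_le_nhds (Ioi_mem_nhds one_pos)] with α hα hα1 hα0 x hx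
  have hα0 : 0 < α := hα0
  have hα1 : α - 1 ≠ 0 := sub_ne_zero.mpr hα1
  rcases hx.1.eq_or_lt with rfl | hx0
  · simp [Real.zero_rpow hα0.ne', hε.le]
  have key := (convex_ball (1 : ℝ) δ).norm_image_sub_le_of_norm_hasDerivWithin_le
    (f := fun c => x ^ c - c * (x * Real.log x))
    (f' := fun c => x ^ c * Real.log x - x * Real.log x) (C := ε)
    (fun c _ => ((Real.hasStrictDerivAt_const_rpow hx0 c).hasDerivAt.sub
      (by simpa using (hasDerivAt_id c).mul_const (x * Real.log x))).hasDerivWithinAt)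
    (fun c hc => by
      have h : dist (x ^ c * Real.log x) (x ^ (1 : ℝ) * Real.log x) < ε := hvε c (hball hc) x hx
      rw [Real.rpow_one, dist_eq_norm] at h
      exact h.le)
    (Metric.mem_ball_self hδ) hα
  have h : (x ^ α - x) / (α - 1) - x * Real.log x
      = (x ^ α - α * (x * Real.log x) - (x ^ (1 : ℝ) - 1 * (x * Real.log x))) / (α - 1) := by
    rw [Real.rpow_one]; field_simp; ring
  rw [h, abs_div, div_le_iff₀ (abs_pos.mpr hα1)]
  exact key

end PowerFunction

section FunctionalCalculus

variable {n : Type*} [Fintype n] [DecidableEq n]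

lemma matPow_eq_cfc {A : Matrix n n ℂ} (hA : A.IsHermitian) (t : ℝ) :
    matPow A t = cfc (fun x : ℝ => if x = 0 then 0 else x ^ t) A := by
  rw [hA.cfc_eq, Matrix.IsHermitian.cfc, Unitary.conjStarAlgAut_apply, matPow, dif_pos hA]
  rfl

lemma matLog2_eq_cfc {A : Matrix n n ℂ} (hA : A.IsHermitian) :
    matLog2 A = cfc (fun x : ℝ => Real.logb 2 x) A := by
  rw [hA.cfc_eq, Matrix.IsHermitian.cfc, Unitary.conjStarAlgAut_apply, matLog2, dif_pos hA]
  congr 3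
  ext i
  by_cases h : hA.eigenvalues i = 0 <;> simp [h]

/-- The weight of `ρ` on the `i`-th eigenvector of `A`. -/
noncomputable def eigenweight {A : Matrix n n ℂ} (hA : A.IsHermitian) (ρ : Matrix n n ℂ)
    (i : n) : ℝ :=
  ((star (hA.eigenvectorUnitary : Matrix n n ℂ)) * ρ * (hA.eigenvectorUnitary : Matrix n n ℂ))
    i i |>.re

lemma trace_mul_cfc {A : Matrix n n ℂ} (hA : A.IsHermitian) (ρ : Matrix n n ℂ) (f : ℝ → ℝ) :
    (ρ * cfc f A).trace.re = ∑ i, eigenweight hA ρ i * f (hA.eigenvalues i) := by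
  rw [hA.cfc_eq, Matrix.IsHermitian.cfc, Unitary.conjStarAlgAut_apply, ← mul_assoc, ← mul_assoc,
    Matrix.trace_mul_comm, ← mul_assoc, ← mul_assoc, Matrix.trace, Complex.re_sum]
  refine Finset.sum_congr rfl fun i _ => ?_
  simp [eigenweight, Matrix.mul_diagonal]

lemma trace_cfc {A : Matrix n n ℂ} (hA : A.IsHermitian) (f : ℝ → ℝ) :
    (cfc f A).trace.re = ∑ i, f (hA.eigenvalues i) := by
  have h := trace_mul_cfc hA 1 f
  simpa [eigenweight] using h

lemma eigenweight_nonneg {A ρ : Matrix n n ℂ} (hA : A.IsHermitian) (hρ : ρ.PosSemidef) (i : n) :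
    0 ≤ eigenweight hA ρ i := by
  have h := (hρ.conjTranspose_mul_mul_same (hA.eigenvectorUnitary : Matrix n n ℂ)).diag_nonneg
    (i := i)
  exact (Complex.le_def.mp h).1

lemma continuousOn_spectrum (A : Matrix n n ℂ) (f : ℝ → ℝ) : ContinuousOn f (spectrum ℝ A) :=
  (Matrix.finite_real_spectrum (A := A)).continuousOn f

lemma cfc_id_of_isHermitian {A : Matrix n n ℂ} (hA : A.IsHermitian) :
    cfc (fun x : ℝ => x) A = A :=
  cfc_id' ℝ A hA

lemma matPow_isHermitian {A : Matrix n n ℂ} (hA : A.IsHermitian) (t : ℝ) :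
    (matPow A t).IsHermitian := by
  rw [matPow_eq_cfc hA]
  exact cfc_predicate _ A

lemma matPow_mul_self {A : Matrix n n ℂ} (hA : A.PosSemidef) (t : ℝ) :
    matPow A t * matPow A t = matPow A (2 * t) := by
  rw [matPow_eq_cfc hA.1, matPow_eq_cfc hA.1, ← cfc_mul _ _ A (continuousOn_spectrum _ _)
    (continuousOn_spectrum _ _)]
  refine cfc_congr fun x hx => ?_
  rw [hA.1.spectrum_real_eq_range_eigenvalues] at hx
  obtain ⟨i, rfl⟩ := hx
  rcases (hA.eigenvalues_nonneg i).eq_or_lt with h | h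
  · simp [← h]
  · simp [h.ne', two_mul, Real.rpow_add h]

lemma mul_matPow_zero {A : Matrix n n ℂ} (hA : A.IsHermitian) : A * matPow A 0 = A := by
  have hid := cfc_id_of_isHermitian hA
  rw [matPow_eq_cfc hA]
  nth_rewrite 1 [← hid]
  rw [← cfc_mul _ _ A (continuousOn_spectrum _ _) (continuousOn_spectrum _ _)]
  conv_rhs => rw [← hid]
  congr 1
  ext x
  by_cases h : x = 0 <;> simp [h]

lemma dominates.mul_matPow_zero {ρ σ : Matrix n n ℂ} (h : dominates σ ρ) (hσ : σ.IsHermitian) :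
    ρ * matPow σ 0 = ρ := by
  refine Matrix.ext_of_mulVec_single fun i => ?_
  have h0 : σ *ᵥ (Pi.single i 1 - matPow σ 0 *ᵥ Pi.single i 1) = 0 := by
    rw [Matrix.mulVec_sub, Matrix.mulVec_mulVec, _root_.mul_matPow_zero hσ, sub_self]
  have h1 := h _ h0
  rw [Matrix.mulVec_sub, Matrix.mulVec_mulVec, sub_eq_zero] at h1
  exact h1.symm

lemma dominates.matPow_zero_mul_mul_matPow_zero {ρ σ : Matrix n n ℂ} (h : dominates σ ρ)
    (hσ : σ.IsHermitian) (hρ : ρ.IsHermitian) : matPow σ 0 * ρ * matPow σ 0 = ρ := by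
  have h1 := h.mul_matPow_zero hσ
  have h2 : matPow σ 0 * ρ = ρ := by
    simpa [Matrix.conjTranspose_mul, hρ.eq, (matPow_isHermitian hσ 0).eq] using
      congrArg Matrix.conjTranspose h1
  rw [h2, h1]

lemma dominates.eigenweight_eq_zero {ρ σ : Matrix n n ℂ} (h : dominates σ ρ)
    (hσ : σ.IsHermitian) {i : n} (hi : hσ.eigenvalues i = 0) : eigenweight hσ ρ i = 0 := by
  have h0 : σ *ᵥ ⇑(hσ.eigenvectorBasis i) = 0 := by
    rw [hσ.mulVec_eigenvectorBasis, hi, zero_smul]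
  have h1 := h _ h0
  rw [eigenweight, mul_assoc, Matrix.mul_apply]
  have h2 (j : n) : (ρ * (hσ.eigenvectorUnitary : Matrix n n ℂ)) j i = 0 := by
    simpa [Matrix.mul_apply, Matrix.mulVec, dotProduct] using congrFun h1 j
  simp [h2]

end FunctionalCalculus

section Continuity

variable {n : Type*} [Fintype n] [DecidableEq n]

lemma continuous_matPow (A : Matrix n n ℂ) : Continuous fun t : ℝ => matPow A t := by
  by_cases hA : A.IsHermitian
  · simp only [matPow, dif_pos hA]
    refine (continuous_const.matrix_mul (Continuous.matrix_diagonal ?_)).matrix_mul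
      continuous_const
    refine continuous_pi fun i => Complex.continuous_ofReal.comp ?_
    by_cases h : hA.eigenvalues i = 0
    · simpa [h] using continuous_const
    · simpa [h] using Real.continuous_const_rpow h
  · simpa [matPow, hA] using continuous_const

lemma eigenvalues_mem_Icc {A : Matrix n n ℂ} (hA : A.PosSemidef) {R : ℝ} (hR : A.trace.re ≤ R)
    (i : n) : hA.1.eigenvalues i ∈ Set.Icc 0 R := by
  refine ⟨hA.eigenvalues_nonneg i, le_trans ?_ hR⟩
  rw [hA.1.trace_eq_sum_eigenvalues, Complex.re_sum]
  exact Finset.single_le_sum (f := fun j => hA.1.eigenvalues j)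
    (fun j _ => hA.eigenvalues_nonneg j) (Finset.mem_univ i)

open scoped Matrix.Norms.L2Operator in
lemma tendsto_cfc_of_posSemidef {X : Type*} {l : Filter X} {M : X → Matrix n n ℂ}
    {A : Matrix n n ℂ} (hM : Tendsto M l (𝓝 A)) (hpos : ∀ x, (M x).PosSemidef)
    (hA : A.PosSemidef) {f : ℝ → ℝ} (hf : Continuous f) :
    Tendsto (fun x => cfc f (M x)) l (𝓝 (cfc f A)) := by
  have htr : Tendsto (fun x => (M x).trace.re) l (𝓝 A.trace.re) :=
    ((Complex.continuous_re.comp (continuous_id.matrix_trace)).tendsto A).comp hM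
  have hsub {B : Matrix n n ℂ} (hB : B.PosSemidef) (h : B.trace.re ≤ A.trace.re + 1) :
      spectrum ℝ B ⊆ Set.Icc 0 (A.trace.re + 1) := by
    rw [hB.1.spectrum_real_eq_range_eigenvalues]
    rintro - ⟨i, rfl⟩
    exact eigenvalues_mem_Icc hB h i
  refine hM.cfc (𝕜 := ℝ) (p := IsSelfAdjoint) (isCompact_Icc (a := 0) (b := A.trace.re + 1)) f ?_
    (Eventually.of_forall fun x => (hpos x).1) (hsub hA (by linarith)) hA.1 hf.continuousOn
  filter_upwards [htr.eventually_le_const (lt_add_one _)] with x hx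
  exact hsub (hpos x) hx

lemma trace_matPow {A : Matrix n n ℂ} (hA : A.IsHermitian) {t : ℝ} (ht : t ≠ 0) :
    (matPow A t).trace.re = ∑ i, hA.eigenvalues i ^ t := by
  rw [matPow_eq_cfc hA, trace_cfc hA]
  refine Finset.sum_congr rfl fun i _ => ?_
  by_cases h : hA.eigenvalues i = 0 <;> simp [h, ht]

lemma tendsto_trace_matPow_sub_div {M : ℝ → Matrix n n ℂ} {A : Matrix n n ℂ}
    (hM : Tendsto M (𝓝[≠] 1) (𝓝 A)) (hpos : ∀ α, (M α).PosSemidef) (hA : A.PosSemidef) :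
    Tendsto (fun α : ℝ => ((matPow (M α) α).trace.re - (M α).trace.re) / (α - 1)) (𝓝[≠] 1)
      (𝓝 (cfc (fun x : ℝ => x * Real.log x) A).trace.re) := by
  have htr : Tendsto (fun x => (M x).trace.re) (𝓝[≠] 1) (𝓝 A.trace.re) :=
    ((Complex.continuous_re.comp (continuous_id.matrix_trace)).tendsto A).comp hM
  have hlim : Tendsto (fun α => (cfc (fun x : ℝ => x * Real.log x) (M α)).trace.re) (𝓝[≠] 1)
      (𝓝 (cfc (fun x : ℝ => x * Real.log x) A).trace.re) :=
    ((Complex.continuous_re.comp (continuous_id.matrix_trace)).tendsto _).comp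
      (tendsto_cfc_of_posSemidef hM hpos hA Real.continuous_mul_log)
  have hdiff : Tendsto (fun α : ℝ => ((matPow (M α) α).trace.re - (M α).trace.re) / (α - 1)
      - (cfc (fun x : ℝ => x * Real.log x) (M α)).trace.re) (𝓝[≠] 1) (𝓝 0) := by
    rw [Metric.tendsto_nhds]
    intro ε hε
    have hc : (0 : ℝ) < Fintype.card n + 1 := by positivity
    filter_upwards [htr.eventually_le_const (lt_add_one _),
      eventually_forall_abs_rpow_sub_le (A.trace.re + 1) (div_pos hε hc),
      nhdsWithin_le_nhds (Ioi_mem_nhds one_pos)] with α h1 h2 h3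
    have h3 : 0 < α := h3
    rw [Real.dist_eq, sub_zero, trace_matPow (hpos α).1 h3.ne', trace_cfc (hpos α).1,
      (hpos α).1.trace_eq_sum_eigenvalues, Complex.re_sum, ← Finset.sum_sub_distrib,
      Finset.sum_div, ← Finset.sum_sub_distrib]
    calc _ ≤ ∑ i : n, ε / (Fintype.card n + 1) :=
          (Finset.abs_sum_le_sum_abs _ _).trans
            (Finset.sum_le_sum fun i _ => h2 _ (eigenvalues_mem_Icc (hpos α) h1 i))
      _ = Fintype.card n * ε / (Fintype.card n + 1) := by simp [mul_div_assoc]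
      _ < ε := by rw [div_lt_iff₀ hc]; nlinarith
  simpa using hdiff.add hlim

end Continuity

section SandwichedDivergence

variable {n : Type*} [Fintype n] [DecidableEq n] {ρ σ : Matrix n n ℂ}

lemma hasDerivAt_trace_mul_matPow (ρ : Matrix n n ℂ) (hσ : σ.PosSemidef) :
    HasDerivAt (fun α : ℝ => (ρ * matPow σ ((1 - α) / α)).trace.re)
      (-(ρ * cfc Real.log σ).trace.re) 1 := by
  have hs : HasDerivAt (fun α : ℝ => (1 - α) / α) (-1) 1 := by
    have h := ((hasDerivAt_id' (1 : ℝ)).const_sub 1).fun_div (hasDerivAt_id' (1 : ℝ)) one_ne_zero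
    exact h.congr_deriv (by norm_num)
  simp only [matPow_eq_cfc hσ.1, trace_mul_cfc hσ.1, ← Finset.sum_neg_distrib]
  refine HasDerivAt.fun_sum fun i _ => ?_
  rcases (hσ.eigenvalues_nonneg i).eq_or_lt with h | h
  · simpa [← h] using hasDerivAt_const (1 : ℝ) (0 : ℝ)
  · simp only [if_neg h.ne']
    exact ((hs.const_rpow h).const_mul (eigenweight hσ.1 ρ i)).congr_deriv (by simp)

lemma dominates.trace_mul_ne_zero (hdom : dominates σ ρ) (hσ : σ.PosSemidef)
    (hρ : ρ.PosSemidef) (hρ0 : ρ ≠ 0) : (ρ * σ).trace ≠ 0 := by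
  intro h
  have hw (i : n) : eigenweight hσ.1 ρ i = 0 := by
    have hsum : ∑ i, eigenweight hσ.1 ρ i * hσ.1.eigenvalues i = 0 := by
      rw [← trace_mul_cfc hσ.1 ρ fun x => x, cfc_id_of_isHermitian hσ.1, h, Complex.zero_re]
    have hi := (Finset.sum_eq_zero_iff_of_nonneg fun i _ =>
      mul_nonneg (eigenweight_nonneg hσ.1 hρ i) (hσ.eigenvalues_nonneg i)).mp hsum i
      (Finset.mem_univ i)
    exact (mul_eq_zero.mp hi).elim id (hdom.eigenweight_eq_zero hσ.1)
  have hre : ρ.trace.re = 0 := by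
    have h1 : cfc (fun _ : ℝ => 1) σ = 1 := cfc_const_one ℝ σ hσ.1
    have := trace_mul_cfc hσ.1 ρ fun _ => 1
    rwa [h1, mul_one, Finset.sum_eq_zero fun i _ => by simp [hw i]] at this
  refine hρ0 (hρ.trace_eq_zero_iff.mp (Complex.ext hre ?_))
  exact (Complex.le_def.mp hρ.trace_nonneg).2.symm

lemma dominates.hasDerivAt_trace_sandwiched (hdom : dominates σ ρ) (hσ : σ.PosSemidef)
    (hρ : ρ.PosSemidef) :
    HasDerivAt (fun α : ℝ => (matPow (matPow σ ((1 - α) / (2 * α)) * ρ *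
        matPow σ ((1 - α) / (2 * α))) α).trace.re)
      ((cfc (fun x : ℝ => x * Real.log x) ρ).trace.re - (ρ * cfc Real.log σ).trace.re) 1 := by
  set M : ℝ → Matrix n n ℂ := fun α =>
    matPow σ ((1 - α) / (2 * α)) * ρ * matPow σ ((1 - α) / (2 * α)) with hMdef
  have hpos (α : ℝ) : (M α).PosSemidef := by
    have h := hρ.mul_mul_conjTranspose_same (matPow σ ((1 - α) / (2 * α)))
    rwa [(matPow_isHermitian hσ.1 _).eq] at h
  have hM1 : M 1 = ρ := by simp [hMdef, hdom.matPow_zero_mul_mul_matPow_zero hσ.1 hρ.1]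
  have hMlim : Tendsto M (𝓝[≠] 1) (𝓝 ρ) := by
    have hs : ContinuousAt (fun α : ℝ => (1 - α) / (2 * α)) 1 :=
      ContinuousAt.div (by fun_prop) (by fun_prop) (by norm_num)
    have hP : ContinuousAt (fun α : ℝ => matPow σ ((1 - α) / (2 * α))) 1 :=
      (continuous_matPow σ).continuousAt.comp hs
    have hc : ContinuousAt M 1 := (hP.mul continuousAt_const).mul hP
    have h := hc.tendsto
    rw [hM1] at h
    exact h.mono_left nhdsWithin_le_nhds
  have hMtr : (fun α => (M α).trace.re) = fun α : ℝ => (ρ * matPow σ ((1 - α) / α)).trace.re := by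
    ext α
    rw [hMdef, Matrix.trace_mul_comm, ← mul_assoc, matPow_mul_self hσ, Matrix.trace_mul_comm,
      ← mul_div_assoc, mul_div_mul_left _ _ two_ne_zero]
  have hlin := hasDerivAt_trace_mul_matPow ρ hσ
  rw [← hMtr] at hlin
  have hlim := (tendsto_trace_matPow_sub_div hMlim hpos hρ).add
    (hasDerivAt_iff_tendsto_slope.mp hlin)
  rw [hasDerivAt_iff_tendsto_slope, sub_eq_add_neg]
  refine hlim.congr fun α => ?_
  have h1 : (matPow (M 1) 1).trace.re = (M 1).trace.re := by
    rw [trace_matPow (hpos 1).1 one_ne_zero, (hpos 1).1.trace_eq_sum_eigenvalues, Complex.re_sum]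
    simp
  rw [slope_def_field, slope_def_field, ← add_div, h1]
  ring

lemma trace_mul_matLog2_sub (hσ : σ.IsHermitian) (hρ : ρ.IsHermitian) :
    (ρ * (matLog2 ρ - matLog2 σ)).trace.re =
      ((cfc (fun x : ℝ => x * Real.log x) ρ).trace.re - (ρ * cfc Real.log σ).trace.re) /
        Real.log 2 := by
  have h : cfc (fun x : ℝ => x * Real.log x) ρ = ρ * cfc Real.log ρ := by
    rw [cfc_mul _ _ ρ (continuousOn_spectrum _ _) (continuousOn_spectrum _ _),
      cfc_id_of_isHermitian hρ]
  rw [h, mul_sub, Matrix.trace_sub, Complex.sub_re, matLog2_eq_cfc hρ, matLog2_eq_cfc hσ,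
    trace_mul_cfc hρ, trace_mul_cfc hσ, trace_mul_cfc hρ, trace_mul_cfc hσ, sub_div,
    Finset.sum_div, Finset.sum_div]
  simp only [Real.logb, mul_div_assoc]

theorem dominates.tendsto_Dtilde (hdom : dominates σ ρ) (hσ : σ.PosSemidef)
    (hρ : ρ.PosSemidef) (hρ0 : ρ ≠ 0) :
    Tendsto (fun α : ℝ => Dtilde α ρ σ) (𝓝[≠] 1)
      (𝓝 (((ρ * (matLog2 ρ - matLog2 σ)).trace.re / ρ.trace.re : ℝ) : EReal)) := by
  have htr : ρ.trace.re ≠ 0 := fun h => hρ0 <| hρ.trace_eq_zero_iff.mp <|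
    Complex.ext h (Complex.le_def.mp hρ.trace_nonneg).2.symm
  have hQ := (hdom.hasDerivAt_trace_sandwiched hσ hρ).div_const ρ.trace.re
  have hQ1 : (matPow (matPow σ ((1 - 1) / (2 * 1)) * ρ * matPow σ ((1 - 1) / (2 * 1)))
      1).trace.re / ρ.trace.re = 1 := by
    rw [sub_self, zero_div, hdom.matPow_zero_mul_mul_matPow_zero hσ.1 hρ.1,
      trace_matPow hρ.1 one_ne_zero, div_eq_one_iff_eq htr, hρ.1.trace_eq_sum_eigenvalues,
      Complex.re_sum]
    simp
  have hlog := (hQ.log (by rw [hQ1]; exact one_ne_zero)).div_const (Real.log 2)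
  have h := hasDerivAt_iff_tendsto_slope.mp hlog
  simp only [Dtilde, if_pos (show (ρ * σ).trace ≠ 0 ∧ (dominates σ ρ ∨ _) from
    ⟨hdom.trace_mul_ne_zero hσ hρ hρ0, Or.inl hdom⟩)]
  refine (continuous_coe_real_ereal.tendsto _).comp ?_
  rw [trace_mul_matLog2_sub hσ.1 hρ.1, div_right_comm]
  rw [hQ1, div_one] at h
  refine h.congr fun α => ?_
  rw [slope_def_field, hQ1, Real.log_one, zero_div, sub_zero, div_eq_inv_mul, Real.logb]

end SandwichedDivergence

/-- the sandwiched Rényi divergence converges to the quantum relative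
entropy `Tr[ρ (log ρ - log σ)] / Tr[ρ]` (base-2 logarithms on the supports) as
`α → 1` both from below and from above. -/
theorem stmt6 {n : ℕ} {ρ σ : Matrix (Fin n) (Fin n) ℂ}
    (hρ : ρ.PosSemidef) (hσ : σ.PosSemidef) (hρ0 : ρ ≠ 0) (hdom : dominates σ ρ) :
    Filter.Tendsto (fun α : ℝ => Dtilde α ρ σ) (nhdsWithin 1 (Set.Iio 1))
      (nhds (((ρ * (matLog2 ρ - matLog2 σ)).trace.re / ρ.trace.re : ℝ) : EReal)) ∧
    Filter.Tendsto (fun α : ℝ => Dtilde α ρ σ) (nhdsWithin 1 (Set.Ioi 1))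
      (nhds (((ρ * (matLog2 ρ - matLog2 σ)).trace.re / ρ.trace.re : ℝ) : EReal)) := by
  have h := hdom.tendsto_Dtilde hσ hρ hρ0
  exact ⟨h.mono_left (nhdsWithin_mono _ fun x hx => ne_of_lt hx),
    h.mono_left (nhdsWithin_mono _ fun x hx => ne_of_gt hx)⟩
end
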